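/- Expected purity of a connected block: let 1 ≤ l < n and let A := {1,…,l} be a block of l consecutive sites. Then the unnormalized reduced state of a random matrix product state satisfies E_{ψ ∼ μ_{d,n,D}} Tr[ρ_A²] ≤ d^{−l} + d^{−(n−l)} + 4·D^{−2}. -/

import Mathlib

open MeasureTheory Matrix
open scoped ComplexConjugate

noncomputable section

instance matrixMeasurableSpace {m n : Type*} : MeasurableSpace (Matrix m n ℂ) :=
  MeasurableSpace.pi

/-- The site tensor `A^{(m)}_i = (⟨i| ⊗ 1_D) U (|0⟩ ⊗ 1_D)`. -/
def siteMat (d D : ℕ) [NeZero d] (U : Matrix.unitaryGroup (Fin d × Fin D) ℂ) (i : Fin d) :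
    Matrix (Fin D) (Fin D) ℂ :=
  Matrix.of fun a b => (U : Matrix (Fin d × Fin D) (Fin d × Fin D) ℂ) (i, a) (0, b)

/-- The (unnormalized) matrix product state `ψ`, with periodic boundary conditions:
`ψ(i₁,…,iₙ) = Tr[A^{(1)}_{i₁} ⋯ A^{(n)}_{iₙ}]`. -/
def mps (d D n : ℕ) [NeZero d] (U : Fin n → Matrix.unitaryGroup (Fin d × Fin D) ℂ) :
    (Fin n → Fin d) → ℂ :=
  fun idx => Matrix.trace (((List.finRange n).map fun m => siteMat d D (U m) (idx m)).prod)
open scoped ComplexOrder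

/-- Merge a configuration on `A` with a configuration on `Aᶜ` into a full configuration. -/
def mergeCfg {n d : ℕ} (A : Finset (Fin n)) (x : (i : A) → Fin d)
    (z : (i : (Aᶜ : Finset (Fin n))) → Fin d) : Fin n → Fin d :=
  fun i => if h : i ∈ A then x ⟨i, h⟩ else z ⟨i, Finset.mem_compl.mpr h⟩

/-- The (unnormalized) reduced density matrix `ρ_A = Tr_{A^c}[|ψ⟩⟨ψ|]` of a vector
`ψ ∈ (ℂ^d)^{⊗n}` on the sites in `A`. -/
def rhoA {n d : ℕ} (A : Finset (Fin n)) (ψ : (Fin n → Fin d) → ℂ) :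
    Matrix ((i : A) → Fin d) ((i : A) → Fin d) ℂ :=
  Matrix.of fun x y =>
    ∑ z : (i : (Aᶜ : Finset (Fin n))) → Fin d, ψ (mergeCfg A x z) * conj (ψ (mergeCfg A y z))

/-- `η(x,y) := (x y² − x)/(x² y² − 1)`. -/
def etaF (x y : ℝ) : ℝ := (x * y ^ 2 - x) / (x ^ 2 * y ^ 2 - 1)

section weingarten

variable {ι : Type} [Fintype ι] [DecidableEq ι]

abbrev UG (ι : Type) [Fintype ι] [DecidableEq ι] := Matrix.unitaryGroup ι ℂ

lemma meas_entry (i j : ι) : Measurable (fun U : UG ι => (U : Matrix ι ι ℂ) i j) := by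
  have h : Measurable (fun U : UG ι => (U : Matrix ι ι ℂ)) := measurable_subtype_coe
  exact (measurable_pi_apply j).comp ((measurable_pi_apply i).comp h)

def monom (j1 j2 l1 l2 i1 i2 k1 k2 : ι) (U : UG ι) : ℂ :=
  (U : Matrix ι ι ℂ) i1 j1 * (U : Matrix ι ι ℂ) i2 j2 *
    conj ((U : Matrix ι ι ℂ) k1 l1) * conj ((U : Matrix ι ι ℂ) k2 l2)

lemma meas_monom (j1 j2 l1 l2 i1 i2 k1 k2 : ι) : Measurable (monom j1 j2 l1 l2 i1 i2 k1 k2) := by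
  unfold monom
  have h := fun i j : ι => meas_entry i j
  have hc : Measurable (fun z : ℂ => conj z) := Complex.continuous_conj.measurable
  exact (((h i1 j1).mul (h i2 j2)).mul (hc.comp (h k1 l1))).mul (hc.comp (h k2 l2))

lemma int_monom (μ : Measure (UG ι)) [IsProbabilityMeasure μ] (j1 j2 l1 l2 i1 i2 k1 k2 : ι) :
    Integrable (monom j1 j2 l1 l2 i1 i2 k1 k2) μ := by
  refine Integrable.of_bound (meas_monom ..).aestronglyMeasurable 1 (Filter.Eventually.of_forall ?_)
  intro U
  have h := fun i j : ι => entry_norm_bound_of_unitary U.2 i j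
  simp only [monom, norm_mul, RCLike.norm_conj]
  have h12 := mul_le_one₀ (h i1 j1) (norm_nonneg _) (h i2 j2)
  have h123 := mul_le_one₀ h12 (norm_nonneg _) (h k1 l1)
  exact mul_le_one₀ h123 (norm_nonneg _) (h k2 l2)

def mom (μ : Measure (UG ι)) (j1 j2 l1 l2 i1 i2 k1 k2 : ι) : ℂ :=
  ∫ U, monom j1 j2 l1 l2 i1 i2 k1 k2 U ∂μ

variable (μ : Measure (UG ι)) [IsProbabilityMeasure μ]
  (hH : ∀ V : UG ι, μ.map (fun U => V * U) = μ)

include hH in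
lemma mom_inv (V : UG ι) (j1 j2 l1 l2 i1 i2 k1 k2 : ι) :
    mom μ j1 j2 l1 l2 i1 i2 k1 k2 = ∫ U, monom j1 j2 l1 l2 i1 i2 k1 k2 (V * U) ∂μ := by
  have hm : AEMeasurable (fun U => V * U) μ := by
    by_contra h
    have := hH V
    rw [Measure.map_of_not_aemeasurable h] at this
    exact IsProbabilityMeasure.ne_zero μ this.symm
  unfold mom
  conv_lhs => rw [← hH V]
  rw [integral_map hm (meas_monom ..).aestronglyMeasurable]

def diagU (v : ι → ℂ) (hv : ∀ i, conj (v i) * v i = 1) : UG ι :=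
  ⟨Matrix.diagonal v, by
    rw [Matrix.mem_unitaryGroup_iff', Matrix.star_eq_conjTranspose, Matrix.diagonal_conjTranspose,
      Matrix.diagonal_mul_diagonal, ← Matrix.diagonal_one]
    congr 1
    ext i
    exact hv i⟩

include hH in
lemma mom_diag (v : ι → ℂ) (hv : ∀ i, conj (v i) * v i = 1) (j1 j2 l1 l2 i1 i2 k1 k2 : ι) :
    mom μ j1 j2 l1 l2 i1 i2 k1 k2 =
      (v i1 * v i2 * conj (v k1) * conj (v k2)) * mom μ j1 j2 l1 l2 i1 i2 k1 k2 := by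
  conv_lhs => rw [mom_inv μ hH (diagU v hv)]
  unfold mom
  rw [← integral_const_mul]
  congr 1
  ext U
  simp only [monom, diagU, Submonoid.coe_mul, Matrix.diagonal_mul, map_mul]
  ring

include hH in
lemma mom_supp (j1 j2 l1 l2 i1 i2 k1 k2 : ι)
    (h : ¬ ((i1 = k1 ∧ i2 = k2) ∨ (i1 = k2 ∧ i2 = k1))) :
    mom μ j1 j2 l1 l2 i1 i2 k1 k2 = 0 := by
  by_contra hne
  have key : ∀ p : ι, ((if i1 = p then Complex.I else 1) * (if i2 = p then Complex.I else 1) *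
      conj (if k1 = p then Complex.I else 1) * conj (if k2 = p then Complex.I else 1) : ℂ) = 1 := by
    intro p
    have := mom_diag μ hH (fun i => if i = p then Complex.I else 1)
      (by intro i; split_ifs <;> simp) j1 j2 l1 l2 i1 i2 k1 k2
    exact (mul_eq_right₀ hne).mp this.symm
  have e1 := key i1
  have e2 := key i2
  clear key hne hH
  by_cases a : i1 = i2
  · subst a
    by_cases b : k1 = i1 <;> by_cases c : k2 = i1 <;>
      simp [b, c, Complex.ext_iff] at e1 h
    all_goals norm_num at e1
  · have a' : ¬ i2 = i1 := fun h => a h.symm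
    by_cases b : k1 = i1 <;> by_cases c : k2 = i1 <;> by_cases b' : k1 = i2 <;>
      by_cases c' : k2 = i2 <;>
      simp_all [Complex.ext_iff]

def permU (σ : Equiv.Perm ι) : UG ι :=
  ⟨σ.permMatrix ℂ, by
    rw [Matrix.mem_unitaryGroup_iff, Matrix.star_eq_conjTranspose]
    ext i j
    simp [Matrix.mul_apply, Equiv.Perm.permMatrix, PEquiv.toMatrix_apply, Matrix.one_apply,
      Equiv.symm_apply_eq]⟩

include hH in
lemma mom_perm (σ : Equiv.Perm ι) (j1 j2 l1 l2 i1 i2 k1 k2 : ι) :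
    mom μ j1 j2 l1 l2 i1 i2 k1 k2 = mom μ j1 j2 l1 l2 (σ i1) (σ i2) (σ k1) (σ k2) := by
  conv_lhs => rw [mom_inv μ hH (permU σ)]
  unfold mom
  congr 1
  ext U
  have : ∀ i j, ((permU σ * U : UG ι) : Matrix ι ι ℂ) i j = (U : Matrix ι ι ℂ) (σ i) j := by
    intro i j
    simp [permU, Equiv.Perm.permMatrix, PEquiv.toMatrix_apply, Matrix.mul_apply]
  simp only [monom, this]

lemma exists_perm (p q i k : ι) (hpq : p ≠ q) (hik : i ≠ k) :
    ∃ σ : Equiv.Perm ι, σ p = i ∧ σ q = k := by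
  refine ⟨Equiv.swap (Equiv.swap p i q) k * Equiv.swap p i, ?_, ?_⟩
  · have h : i ≠ Equiv.swap p i q := by
      intro h
      have h2 : Equiv.swap p i p = Equiv.swap p i q := by rw [Equiv.swap_apply_left]; exact h
      exact hpq ((Equiv.swap p i).injective h2)
    simp [Equiv.swap_apply_of_ne_of_ne h hik]
  · simp

def wv (p q : ι) : ι → ℂ := Pi.single p 1 + Pi.single q 2

lemma wv_dot (p q : ι) (h : p ≠ q) : wv p q ⬝ᵥ wv p q = 5 := by
  have h' := h.symm
  simp [wv, dotProduct_add, h, h']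
  norm_num

def reflU (p q : ι) (h : p ≠ q) : UG ι :=
  ⟨1 - (2/5 : ℂ) • Matrix.vecMulVec (wv p q) (wv p q), by
    rw [Matrix.mem_unitaryGroup_iff, Matrix.star_eq_conjTranspose]
    have hs : (Matrix.vecMulVec (wv p q) (wv p q))ᴴ = Matrix.vecMulVec (wv p q) (wv p q) := by
      ext i j
      simp only [Matrix.conjTranspose_apply, Matrix.vecMulVec_apply, wv, Pi.add_apply,
        Pi.single_apply]
      split_ifs <;> simp [mul_comm]
    have hm : Matrix.vecMulVec (wv p q) (wv p q) * Matrix.vecMulVec (wv p q) (wv p q)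
        = (5:ℂ) • Matrix.vecMulVec (wv p q) (wv p q) := by
      rw [Matrix.vecMulVec_mul_vecMulVec, wv_dot p q h]
      ext i j
      simp [Matrix.vecMulVec_apply]
      try ring
    rw [Matrix.conjTranspose_sub, Matrix.conjTranspose_smul, hs, Matrix.conjTranspose_one]
    simp only [sub_mul, mul_sub, one_mul, mul_one, Matrix.smul_mul, Matrix.mul_smul, hm, smul_smul]
    ext i j
    simp
    ring⟩

lemma reflU_row (p q : ι) (h : p ≠ q) (U : UG ι) (j : ι) :
    ((reflU p q h * U : UG ι) : Matrix ι ι ℂ) p j =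
      ∑ x : Bool, (bif x then (3/5 : ℝ) else (-4/5 : ℝ) : ℝ) *
        (U : Matrix ι ι ℂ) (bif x then p else q) j := by
  have h1 : ((reflU p q h * U : UG ι) : Matrix ι ι ℂ) =
    U - (2/5 : ℂ) • (Matrix.vecMulVec (wv p q) (wv p q) * (U : Matrix ι ι ℂ)) := by
    simp [reflU, sub_mul]
  have h2 : (Matrix.vecMulVec (wv p q) (wv p q) * (U : Matrix ι ι ℂ)) p j
      = (U : Matrix ι ι ℂ) p j + 2 * (U : Matrix ι ι ℂ) q j := by
    rw [Matrix.vecMulVec_mul, Matrix.vecMulVec_apply]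
    simp [wv, Matrix.add_vecMul, h]
  rw [h1, Matrix.sub_apply, Matrix.smul_apply, h2]
  simp
  ring

lemma integral_sum4 (f : Bool → Bool → Bool → Bool → UG ι → ℂ)
    (hf : ∀ x y z w, Integrable (f x y z w) μ) :
    ∫ U, ∑ x, ∑ y, ∑ z, ∑ w, f x y z w U ∂μ = ∑ x, ∑ y, ∑ z, ∑ w, ∫ U, f x y z w U ∂μ := by
  rw [integral_finsetSum _ (fun x _ => integrable_finsetSum _ fun y _ =>
    integrable_finsetSum _ fun z _ => integrable_finsetSum _ fun w _ => hf x y z w)]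
  refine Finset.sum_congr rfl fun x _ => ?_
  rw [integral_finsetSum _ (fun y _ =>
    integrable_finsetSum _ fun z _ => integrable_finsetSum _ fun w _ => hf x y z w)]
  refine Finset.sum_congr rfl fun y _ => ?_
  rw [integral_finsetSum _ (fun z _ => integrable_finsetSum _ fun w _ => hf x y z w)]
  refine Finset.sum_congr rfl fun z _ => ?_
  rw [integral_finsetSum _ (fun w _ => hf x y z w)]

include hH in
lemma mom_refl (p q : ι) (h : p ≠ q) (j1 j2 l1 l2 : ι) :
    mom μ j1 j2 l1 l2 p p p p = mom μ j1 j2 l1 l2 p q p q + mom μ j1 j2 l1 l2 p q q p := by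
  have h' := h.symm
  have e : mom μ j1 j2 l1 l2 p p p p = ∑ x : Bool, ∑ y : Bool, ∑ z : Bool, ∑ w : Bool,
      (((bif x then (3/5 : ℝ) else (-4/5 : ℝ) : ℝ) : ℂ) * ((bif y then (3/5 : ℝ) else (-4/5 : ℝ) : ℝ))
       * ((bif z then (3/5 : ℝ) else (-4/5 : ℝ) : ℝ)) * ((bif w then (3/5 : ℝ) else (-4/5 : ℝ) : ℝ))) *
      mom μ j1 j2 l1 l2 (bif x then p else q) (bif y then p else q) (bif z then p else q)
        (bif w then p else q) := by
    rw [mom_inv μ hH (reflU p q h)]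
    unfold mom
    simp_rw [← integral_const_mul]
    have hi := fun a b c d e => (int_monom μ j1 j2 l1 l2 a b c d).const_mul e
    rw [← integral_sum4 μ (fun x y z w U => (((bif x then (3/5 : ℝ) else (-4/5 : ℝ) : ℝ) : ℂ) * ((bif y then (3/5 : ℝ) else (-4/5 : ℝ) : ℝ))
       * ((bif z then (3/5 : ℝ) else (-4/5 : ℝ) : ℝ)) * ((bif w then (3/5 : ℝ) else (-4/5 : ℝ) : ℝ))) *
      monom j1 j2 l1 l2 (bif x then p else q) (bif y then p else q) (bif z then p else q)
        (bif w then p else q) U) (fun x y z w => hi _ _ _ _ _)]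
    congr 1
    ext U
    simp only [monom, reflU_row, map_sum, map_mul, Complex.conj_ofReal]
    simp only [Fintype.sum_bool, cond_true, cond_false]
    ring
  have s1 : mom μ j1 j2 l1 l2 q q q q = mom μ j1 j2 l1 l2 p p p p := by
    simpa using mom_perm μ hH (Equiv.swap p q) j1 j2 l1 l2 q q q q
  have s2 : mom μ j1 j2 l1 l2 q p q p = mom μ j1 j2 l1 l2 p q p q := by
    simpa using mom_perm μ hH (Equiv.swap p q) j1 j2 l1 l2 q p q p
  have s3 : mom μ j1 j2 l1 l2 q p p q = mom μ j1 j2 l1 l2 p q q p := by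
    simpa using mom_perm μ hH (Equiv.swap p q) j1 j2 l1 l2 q p p q
  have z := mom_supp μ hH j1 j2 l1 l2
  simp only [Fintype.sum_bool, cond_true, cond_false, s1, s2, s3] at e
  rw [z p p p q (by simp [h]), z p p q p (by simp [h]), z p p q q (by simp [h]),
    z p q p p (by simp [h']), z p q q q (by simp [h]), z q p p p (by simp [h']),
    z q p q q (by simp [h]), z q q p p (by simp [h']), z q q p q (by simp [h']),
    z q q q p (by simp [h'])] at e
  push_cast at e
  linear_combination (625/288 : ℂ) * e

include hH in
lemma mom_form (p q : ι) (h : p ≠ q) (j1 j2 l1 l2 i1 i2 k1 k2 : ι) :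
    mom μ j1 j2 l1 l2 i1 i2 k1 k2 =
      mom μ j1 j2 l1 l2 p q p q * (if i1 = k1 ∧ i2 = k2 then 1 else 0) +
      mom μ j1 j2 l1 l2 p q q p * (if i1 = k2 ∧ i2 = k1 then 1 else 0) := by
  by_cases hs : ((i1 = k1 ∧ i2 = k2) ∨ (i1 = k2 ∧ i2 = k1))
  · by_cases hi : i1 = i2
    · have : i1 = k1 ∧ i1 = k2 := by
        subst hi; tauto
      obtain ⟨h1, h2⟩ := this
      subst hi; subst h1; subst h2
      have := mom_perm μ hH (Equiv.swap p i1) j1 j2 l1 l2 i1 i1 i1 i1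
      simp only [Equiv.swap_apply_right] at this
      rw [this, mom_refl μ hH p q h]
      simp
    · obtain ⟨σ, hp, hq⟩ := exists_perm p q i1 i2 h hi
      have hi' : ¬ i2 = i1 := fun h => hi h.symm
      rcases hs with ⟨h1, h2⟩ | ⟨h1, h2⟩
      · subst h1; subst h2
        have := mom_perm μ hH σ j1 j2 l1 l2 p q p q
        rw [hp, hq] at this
        simp [this, hi]
      · subst h1; subst h2
        have := mom_perm μ hH σ j1 j2 l1 l2 p q q p
        rw [hp, hq] at this
        simp [this, hi]
  · rw [mom_supp μ hH _ _ _ _ _ _ _ _ hs]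
    rw [not_or] at hs
    simp [hs.1, hs.2]

lemma col_orth (U : UG ι) (j l : ι) :
    ∑ i, (U : Matrix ι ι ℂ) i j * conj ((U : Matrix ι ι ℂ) i l) = if j = l then 1 else 0 := by
  have h := Matrix.mem_unitaryGroup_iff'.mp U.2
  have := congrFun (congrFun h l) j
  rw [Matrix.mul_apply, Matrix.one_apply] at this
  simp only [eq_comm (a := j)]
  rw [← this]
  refine Finset.sum_congr rfl fun i _ => ?_
  rw [Matrix.star_apply, mul_comm]; rfl

lemma contract1 (j1 j2 l1 l2 : ι) : ∑ i1, ∑ i2, mom μ j1 j2 l1 l2 i1 i2 i1 i2 =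
    (if j1 = l1 then 1 else 0) * (if j2 = l2 then 1 else 0) := by
  unfold mom
  have hi := fun a b c d => (int_monom μ j1 j2 l1 l2 a b c d)
  simp_rw [← integral_finsetSum _ (fun _ _ => hi _ _ _ _)]
  rw [← integral_finsetSum _ (fun _ _ => integrable_finsetSum _ (fun _ _ => hi _ _ _ _))]
  have : ∀ U : UG ι, ∑ i1, ∑ i2, monom j1 j2 l1 l2 i1 i2 i1 i2 U =
    (if j1 = l1 then 1 else 0) * (if j2 = l2 then 1 else 0) := by
    intro U
    rw [← col_orth U, ← col_orth U, Finset.sum_mul_sum]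
    refine Finset.sum_congr rfl fun i _ => Finset.sum_congr rfl fun k _ => ?_
    unfold monom; ring
  simp_rw [this]
  simp

lemma contract2 (j1 j2 l1 l2 : ι) : ∑ i1, ∑ i2, mom μ j1 j2 l1 l2 i1 i2 i2 i1 =
    (if j1 = l2 then 1 else 0) * (if j2 = l1 then 1 else 0) := by
  rw [← contract1 μ j1 j2 l2 l1]
  refine Finset.sum_congr rfl fun i _ => Finset.sum_congr rfl fun k _ => ?_
  unfold mom monom
  congr 1; ext U; ring

include hH in
theorem weingarten (hc : 2 ≤ Fintype.card ι) (j1 j2 l1 l2 i1 i2 k1 k2 : ι) :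
    mom μ j1 j2 l1 l2 i1 i2 k1 k2 =
      (((if j1 = l1 ∧ j2 = l2 then 1 else 0) - (if j1 = l2 ∧ j2 = l1 then 1 else 0) / (Fintype.card ι : ℂ))
        / ((Fintype.card ι : ℂ)^2 - 1)) * (if i1 = k1 ∧ i2 = k2 then 1 else 0) +
      (((if j1 = l2 ∧ j2 = l1 then 1 else 0) - (if j1 = l1 ∧ j2 = l2 then 1 else 0) / (Fintype.card ι : ℂ))
        / ((Fintype.card ι : ℂ)^2 - 1)) * (if i1 = k2 ∧ i2 = k1 then 1 else 0) := by
  obtain ⟨p, q, h⟩ := Fintype.exists_pair_of_one_lt_card (α := ι) (by omega)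
  have e1 := contract1 μ j1 j2 l1 l2
  have e2 := contract2 μ j1 j2 l1 l2
  have hf := mom_form μ hH p q h j1 j2 l1 l2
  rw [hf i1 i2 k1 k2]
  have a1 : ∀ b c : ℂ, ∑ i1 : ι, ∑ i2 : ι, (b * (if i1 = i1 ∧ i2 = i2 then 1 else 0) +
      c * (if i1 = i2 ∧ i2 = i1 then 1 else 0)) =
      b * (Fintype.card ι : ℂ)^2 + c * (Fintype.card ι : ℂ) := by
    intro b c
    have : ∀ x y : ι, (x = y ∧ y = x) ↔ x = y := by
      intro x y; constructor
      · exact fun h => h.1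
      · exact fun h => ⟨h, h.symm⟩
    simp [this, Finset.sum_add_distrib]
    ring
  have a2 : ∀ b c : ℂ, ∑ i1 : ι, ∑ i2 : ι, (b * (if i1 = i2 ∧ i2 = i1 then 1 else 0) +
      c * (if i1 = i1 ∧ i2 = i2 then 1 else 0)) =
      b * (Fintype.card ι : ℂ) + c * (Fintype.card ι : ℂ)^2 := by
    intro b c
    have := a1 c b
    rw [add_comm (b * _), ← this]
    refine Finset.sum_congr rfl fun i _ => Finset.sum_congr rfl fun k _ => ?_
    ring
  have g1 : ∑ i1, ∑ i2, mom μ j1 j2 l1 l2 i1 i2 i1 i2 = _ :=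
    Finset.sum_congr rfl fun i1 _ => Finset.sum_congr rfl fun i2 _ => hf i1 i2 i1 i2
  have g2 : ∑ i1, ∑ i2, mom μ j1 j2 l1 l2 i1 i2 i2 i1 = _ :=
    Finset.sum_congr rfl fun i1 _ => Finset.sum_congr rfl fun i2 _ => hf i1 i2 i2 i1
  rw [a1, e1] at g1
  rw [a2, e2] at g2
  have c1 : (if j1 = l1 ∧ j2 = l2 then (1:ℂ) else 0) =
      (if j1 = l1 then 1 else 0) * (if j2 = l2 then 1 else 0) := by
    by_cases h1 : j1 = l1 <;> by_cases h2 : j2 = l2 <;> simp [h1, h2]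
  have c2 : (if j1 = l2 ∧ j2 = l1 then (1:ℂ) else 0) =
      (if j1 = l2 then 1 else 0) * (if j2 = l1 then 1 else 0) := by
    by_cases h1 : j1 = l2 <;> by_cases h2 : j2 = l1 <;> simp [h1, h2]
  rw [← c1] at g1
  rw [← c2] at g2
  have hN : (Fintype.card ι : ℂ) ≠ 0 := by
    exact_mod_cast (by omega : Fintype.card ι ≠ 0)
  have hN2 : (Fintype.card ι : ℂ)^2 - 1 ≠ 0 := by
    rw [sub_ne_zero]
    have : (Fintype.card ι)^2 ≠ 1 := by nlinarith
    exact_mod_cast this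
  rw [g1, g2]
  congr 2
  · field_simp
    ring
  · field_simp
    ring

end weingarten

section paths

def prv (k : ℕ) : Fin (k+1) → Fin (k+1) := fun m =>
  (Fin.cons (Fin.last k) id : Fin (k+2) → Fin (k+1)) m.castSucc

lemma open_path {β : Type} [Fintype β] [DecidableEq β] : ∀ (n : ℕ) (M : Fin n → Matrix β β ℂ)
    (a b : β), (List.ofFn M).prod a b = ∑ p : Fin n → β,
      (∏ m, M m ((Fin.cons a p : Fin (n+1) → β) m.castSucc) (p m)) *
        if (Fin.cons a p : Fin (n+1) → β) (Fin.last n) = b then 1 else 0 := by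
  intro n
  induction n with
  | zero =>
    intro M a b
    simp [Matrix.one_apply]
  | succ n ih =>
    intro M a b
    rw [List.ofFn_succ, List.prod_cons, Matrix.mul_apply,
      ← (Fin.consEquiv (fun _ : Fin (n+1) => β)).sum_comp, Fintype.sum_prod_type]
    refine Finset.sum_congr rfl fun c _ => ?_
    rw [ih, Finset.mul_sum]
    refine Finset.sum_congr rfl fun p _ => ?_
    rw [Fin.prod_univ_succ, ← Fin.succ_last]
    simp only [Fin.consEquiv_apply, Fin.cons_succ, Fin.cons_zero, Fin.castSucc_zero,
      ← Fin.succ_castSucc, mul_assoc]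

lemma trace_path {β : Type} [Fintype β] [DecidableEq β] (k : ℕ)
    (M : Fin (k+1) → Matrix β β ℂ) :
    Matrix.trace ((List.finRange (k+1)).map M).prod =
      ∑ p : Fin (k+1) → β, ∏ m, M m (p (prv k m)) (p m) := by
  rw [← List.ofFn_eq_map, Matrix.trace]
  simp only [Matrix.diag_apply, open_path]
  rw [Finset.sum_comm]
  refine Finset.sum_congr rfl fun p _ => ?_
  simp only [← Fin.succ_last, Fin.cons_succ, mul_ite, mul_one, mul_zero]
  rw [Finset.sum_ite_eq]
  simp only [Finset.mem_univ, if_true]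
  refine Finset.prod_congr rfl fun m _ => ?_
  congr 1
  unfold prv
  refine Fin.cases ?_ (fun i => ?_) m
  · simp
  · simp only [← Fin.succ_castSucc, Fin.cons_succ, id]

lemma sum_pi_prod {I α β : Type} [Fintype I] [DecidableEq I] [Fintype α] [Fintype β]
    (F : (I → α × β) → ℂ) : ∑ P, F P = ∑ p : I → α, ∑ q : I → β, F (fun i => (p i, q i)) := by
  rw [← (Equiv.arrowProdEquivProdArrow I (fun _ => α) (fun _ => β)).symm.sum_comp,
    Fintype.sum_prod_type]
  rfl

def mix {n d : ℕ} (A : Finset (Fin n)) (t s : Fin n → Fin d) : Fin n → Fin d :=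
  fun i => if i ∈ A then t i else s i

def mergeEquiv {n d : ℕ} (A : Finset (Fin n)) :
    (((i : A) → Fin d) × ((i : (Aᶜ : Finset (Fin n))) → Fin d)) ≃ (Fin n → Fin d) where
  toFun p := mergeCfg A p.1 p.2
  invFun s := (fun i => s i, fun i => s i)
  left_inv p := by
    ext i
    · simp [mergeCfg]
    · have := Finset.mem_compl.mp i.2
      simp [mergeCfg, this]
  right_inv s := by
    ext i
    simp [mergeCfg]

lemma sum_merge {n d : ℕ} (A : Finset (Fin n)) (F : (Fin n → Fin d) → ℂ) :
    ∑ s, F s = ∑ x, ∑ z, F (mergeCfg A x z) := by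
  rw [← (mergeEquiv A).sum_comp, Fintype.sum_prod_type]
  rfl

lemma purity_expand {n d : ℕ} (A : Finset (Fin n)) (ψ : (Fin n → Fin d) → ℂ) :
    Matrix.trace (rhoA A ψ * rhoA A ψ) =
      ∑ s, ∑ t, ψ s * ψ t * conj (ψ (mix A t s)) * conj (ψ (mix A s t)) := by
  rw [sum_merge A]
  have h0 : ∀ s : Fin n → Fin d, ∑ t, ψ s * ψ t * conj (ψ (mix A t s)) * conj (ψ (mix A s t)) =
      ∑ y, ∑ w, ψ s * ψ (mergeCfg A y w) * conj (ψ (mix A (mergeCfg A y w) s)) *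
        conj (ψ (mix A s (mergeCfg A y w))) := fun s => sum_merge A _
  simp_rw [h0]
  rw [Matrix.trace]
  simp only [Matrix.diag_apply, Matrix.mul_apply]
  refine Finset.sum_congr rfl fun x _ => ?_
  conv_rhs => rw [Finset.sum_comm]
  refine Finset.sum_congr rfl fun y _ => ?_
  simp only [rhoA, Matrix.of_apply]
  rw [Finset.sum_mul_sum]
  refine Finset.sum_congr rfl fun z _ => Finset.sum_congr rfl fun w _ => ?_
  have h1 : ∀ (x y : (i : A) → Fin d) (z w), mix A (mergeCfg A y w) (mergeCfg A x z) = mergeCfg A y z := by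
    intro x y z w
    ext i
    by_cases h : i ∈ A <;> simp [mix, mergeCfg, h]
  rw [h1, h1]
  ring

abbrev Q (D : ℕ) := Fin D × Fin D × Fin D × Fin D

def KK {n : ℕ} (d D : ℕ) [NeZero d] (A : Finset (Fin n)) (m : Fin n)
    (U : Matrix.unitaryGroup (Fin d × Fin D) ℂ) (a b : Q D) (s t : Fin d) : ℂ :=
  siteMat d D U s a.1 b.1 * siteMat d D U t a.2.1 b.2.1 *
    conj (siteMat d D U (if m ∈ A then t else s) a.2.2.1 b.2.2.1) *
    conj (siteMat d D U (if m ∈ A then s else t) a.2.2.2 b.2.2.2)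

lemma purity_path (k d D : ℕ) [NeZero d] (A : Finset (Fin (k+1)))
    (U : Fin (k+1) → Matrix.unitaryGroup (Fin d × Fin D) ℂ) :
    Matrix.trace (rhoA A (mps d D (k+1) U) * rhoA A (mps d D (k+1) U)) =
      ∑ P : Fin (k+1) → Q D, ∏ m, ∑ s, ∑ t, KK d D A m (U m) (P (prv k m)) (P m) s t := by
  rw [purity_expand]
  have e1 : ∀ P : Fin (k+1) → Q D, ∏ m, ∑ s, ∑ t, KK d D A m (U m) (P (prv k m)) (P m) s t =
      ∑ s : Fin (k+1) → Fin d, ∑ t : Fin (k+1) → Fin d,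
        ∏ m, KK d D A m (U m) (P (prv k m)) (P m) (s m) (t m) := by
    intro P
    rw [← sum_pi_prod (fun st : Fin (k+1) → Fin d × Fin d =>
      ∏ m, KK d D A m (U m) (P (prv k m)) (P m) (st m).1 (st m).2)]
    have h0 : ∀ m, ∑ s, ∑ t, KK d D A m (U m) (P (prv k m)) (P m) s t = ∑ st : Fin d × Fin d, KK d D A m (U m) (P (prv k m)) (P m) st.1 st.2 :=
      fun m => (Fintype.sum_prod_type' _).symm
    simp_rw [h0]
    rw [Finset.prod_univ_sum]
    simp
  simp_rw [e1]
  conv_rhs => rw [Finset.sum_comm]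
  refine Finset.sum_congr rfl fun s _ => ?_
  conv_rhs => rw [Finset.sum_comm]
  refine Finset.sum_congr rfl fun t _ => ?_
  rw [sum_pi_prod]
  simp_rw [sum_pi_prod (α := Fin D)]
  unfold mps
  simp only [trace_path, map_sum, map_prod]
  simp only [KK, Finset.prod_mul_distrib, mul_assoc, ← Finset.mul_sum, mix, ← Finset.sum_mul]

lemma trace_cyc {α β : Type} [Fintype α] [Fintype β] [DecidableEq α] [DecidableEq β] {I : Type}
    (B : Matrix α β ℂ) (C : I → Matrix β α ℂ) (L : List I) (hL : L ≠ []) :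
    Matrix.trace (L.map (fun m => B * C m)).prod = Matrix.trace (L.map (fun m => C m * B)).prod := by
  have h : ∀ L : List I, (L.map (fun m => B * C m)).prod * B = B * (L.map (fun m => C m * B)).prod := by
    intro L
    induction L with
    | nil => simp
    | cons m L ih =>
      simp only [List.map_cons, List.prod_cons]
      rw [Matrix.mul_assoc, ih]
      simp only [Matrix.mul_assoc]
  cases L with
  | nil => exact absurd rfl hL
  | cons m L =>
    simp only [List.map_cons, List.prod_cons]
    rw [Matrix.mul_assoc, Matrix.trace_mul_comm, Matrix.mul_assoc, h, Matrix.mul_assoc]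

def BB (D : ℕ) : Matrix (Q D) (Fin 2) ℂ := Matrix.of fun a σ =>
  if σ = 0 then (if a.1 = a.2.2.1 ∧ a.2.1 = a.2.2.2 then 1 else 0)
  else (if a.1 = a.2.2.2 ∧ a.2.1 = a.2.2.1 then 1 else 0)

def WW (d D : ℕ) : Matrix (Fin 2) (Fin 2) ℂ :=
  !![1 / (((d:ℂ) * D)^2 - 1), - (1 / ((d:ℂ) * D)) / (((d:ℂ) * D)^2 - 1);
     - (1 / ((d:ℂ) * D)) / (((d:ℂ) * D)^2 - 1), 1 / (((d:ℂ) * D)^2 - 1)]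

def CC {n : ℕ} (d D : ℕ) (A : Finset (Fin n)) (m : Fin n) : Matrix (Fin 2) (Q D) ℂ :=
  (if m ∈ A then !![(d:ℂ), 0; 0, (d:ℂ)^2] else !![(d:ℂ)^2, 0; 0, (d:ℂ)]) * WW d D * (BB D)ᵀ

lemma site_int {n : ℕ} (d D : ℕ) [NeZero d] (hd : 2 ≤ d) (hD : 2 ≤ D) (A : Finset (Fin n))
    (m : Fin n) (μ : Measure (Matrix.unitaryGroup (Fin d × Fin D) ℂ)) [IsProbabilityMeasure μ]
    (hHaar : ∀ V : Matrix.unitaryGroup (Fin d × Fin D) ℂ, μ.map (fun U => V * U) = μ)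
    (a b : Q D) :
    ∫ U, ∑ s, ∑ t, KK d D A m U a b s t ∂μ = (BB D * CC d D A m) a b := by
  have hi : ∀ s t, Integrable (fun U => KK d D A m U a b s t) μ := fun s t => int_monom μ _ _ _ _ _ _ _ _
  rw [integral_finsetSum _ (fun s _ => integrable_finsetSum _ fun t _ => hi s t)]
  simp_rw [integral_finsetSum _ (fun t _ => hi _ t)]
  have hc : 2 ≤ Fintype.card (Fin d × Fin D) := by
    simp; nlinarith
  have e : ∀ s t, ∫ U, KK d D A m U a b s t ∂μ = mom μ (0, b.1) (0, b.2.1) (0, b.2.2.1) (0, b.2.2.2)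
    (s, a.1) (t, a.2.1) ((if m ∈ A then t else s), a.2.2.1) ((if m ∈ A then s else t), a.2.2.2) :=
    fun s t => rfl
  simp_rw [e, weingarten μ hHaar hc]
  have hcard : (Fintype.card (Fin d × Fin D) : ℂ) = (d:ℂ) * D := by simp
  rw [hcard]
  obtain ⟨a1, a2, a3, a4⟩ := a
  obtain ⟨b1, b2, b3, b4⟩ := b
  simp only [Prod.mk.injEq, true_and]
  have s1 : ∀ s t : Fin d, ∀ p q : Prop, [Decidable p] → [Decidable q] →
      (if (s = t ∧ p) ∧ t = s ∧ q then (1:ℂ) else 0) = (if s = t then 1 else 0) * (if p ∧ q then 1 else 0) := by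
    intro s t p q _ _
    by_cases h : s = t
    · subst h; simp
    · simp [h]
  by_cases hm : m ∈ A
  · simp only [hm, if_true, CC, s1, true_and, Finset.sum_add_distrib, ← Finset.mul_sum, ← Finset.sum_mul]
    simp [BB, WW, Matrix.mul_apply, Fin.sum_univ_two, Matrix.vecMul, dotProduct]
    split_ifs <;> ring
  · simp only [hm, if_false, CC, s1, true_and, Finset.sum_add_distrib, ← Finset.mul_sum, ← Finset.sum_mul]
    simp [BB, WW, Matrix.mul_apply, Fin.sum_univ_two, Matrix.vecMul, dotProduct]
    split_ifs <;> ring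

lemma BB_gram (D : ℕ) : (BB D)ᵀ * BB D = !![(D:ℂ)^2, (D:ℂ); (D:ℂ), (D:ℂ)^2] := by
  have h : ∀ p q r s : Prop, [Decidable p] → [Decidable q] → [Decidable r] → [Decidable s] →
    (if p ∧ q then (1:ℂ) else 0) * (if r ∧ s then 1 else 0) =
      if p then (if r then (if q then (if s then 1 else 0) else 0) else 0) else 0 := by
    intro p q r s _ _ _ _
    by_cases p <;> by_cases q <;> by_cases r <;> by_cases s <;> simp_all
  ext i j
  fin_cases i <;> fin_cases j <;>
    simp [Matrix.mul_apply, BB, Fintype.sum_prod_type, h, -mul_ite, -ite_mul] <;> ring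

lemma integral_purity (k d D : ℕ) [NeZero d] (hd : 2 ≤ d) (hD : 2 ≤ D) (A : Finset (Fin (k+1)))
    (μ : Measure (Matrix.unitaryGroup (Fin d × Fin D) ℂ)) [IsProbabilityMeasure μ]
    (hHaar : ∀ V : Matrix.unitaryGroup (Fin d × Fin D) ℂ, μ.map (fun U => V * U) = μ) :
    ∫ U, Matrix.trace (rhoA A (mps d D (k+1) U) * rhoA A (mps d D (k+1) U))
        ∂(Measure.pi fun _ : Fin (k+1) => μ) =
    Matrix.trace ((List.finRange (k+1)).map (fun m => CC d D A m * BB D)).prod := by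
  rw [← trace_cyc _ _ _ (by simp), trace_path]
  simp_rw [purity_path]
  have hi : ∀ m a b, Integrable (fun U => ∑ s, ∑ t, KK d D A m U a b s t) μ := fun m a b =>
    integrable_finsetSum _ fun s _ => integrable_finsetSum _ fun t _ => int_monom μ _ _ _ _ _ _ _ _
  rw [integral_finsetSum]
  · refine Finset.sum_congr rfl fun P _ => ?_
    rw [integral_fintype_prod_eq_prod (fun m U => ∑ s, ∑ t, KK d D A m U (P (prv k m)) (P m) s t)]
    exact Finset.prod_congr rfl fun m _ => site_int d D hd hD A m μ hHaar _ _
  · intro P _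
    exact Integrable.fintype_prod (f := fun m U => ∑ s, ∑ t, KK d D A m U (P (prv k m)) (P m) s t)
      (fun m => hi m _ _)

end paths

section final

lemma list_split {α : Type} [Monoid α] (l n : ℕ) (h : l ≤ n) (X Y : α) :
    ((List.finRange n).map (fun m : Fin n => if (m : ℕ) < l then X else Y)).prod = X^l * Y^(n-l) := by
  obtain ⟨r, rfl⟩ := Nat.exists_eq_add_of_le h
  rw [← List.ofFn_eq_map, List.ofFn_add]
  simp

def RC (x y : ℂ) : Matrix (Fin 2) (Fin 2) ℂ :=
  !![x*y^2/(x*y^2+1), x*y/(x*y^2+1); y/(x*y^2+1), 1/(x*y^2+1)]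
def RA (x y : ℂ) : Matrix (Fin 2) (Fin 2) ℂ :=
  !![1/(x*y^2+1), y/(x*y^2+1); x*y/(x*y^2+1), x*y^2/(x*y^2+1)]

lemma proj_pow (R : Matrix (Fin 2) (Fin 2) ℂ) (h : R * R = R) (e : ℂ) (k : ℕ) :
    (R + e • (1 - R))^k = R + e^k • (1 - R) := by
  induction k with
  | zero => simp
  | succ k ih =>
    rw [pow_succ, ih, pow_succ]
    simp only [add_mul, mul_add, Matrix.smul_mul, Matrix.mul_smul, mul_sub, sub_mul, h, one_mul,
      mul_one, sub_self, smul_zero, add_zero, zero_add, sub_zero, smul_smul, mul_comm e]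

lemma RC_proj (x y : ℂ) (h : x*y^2+1 ≠ 0) : RC x y * RC x y = RC x y := by
  ext i j
  fin_cases i <;> fin_cases j <;> simp [RC, Matrix.mul_apply, Fin.sum_univ_two] <;> field_simp <;> try ring

lemma RA_proj (x y : ℂ) (h : x*y^2+1 ≠ 0) : RA x y * RA x y = RA x y := by
  ext i j
  fin_cases i <;> fin_cases j <;> simp [RA, Matrix.mul_apply, Fin.sum_univ_two] <;> field_simp <;> try ring

lemma trace_final (x y a b : ℂ) (h : x*y^2+1 ≠ 0) :
    Matrix.trace ((RA x y + a • (1 - RA x y)) * (RC x y + b • (1 - RC x y))) =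
      (y*(x+1)/(x*y^2+1))^2 * (1 + a*b) + (a+b) * (1 - (y*(x+1)/(x*y^2+1))^2) := by
  simp [RA, RC, Matrix.trace, Matrix.mul_apply, Fin.sum_univ_two]
  field_simp
  ring

lemma T_eq {n : ℕ} (d D : ℕ) (hd : 2 ≤ d) (hD : 2 ≤ D) (A : Finset (Fin n)) (m : Fin n) :
    CC d D A m * BB D =
      if m ∈ A then RA d D + (d * ((D:ℂ)^2-1) / ((d * D)^2-1)) • (1 - RA d D)
      else RC d D + (d * ((D:ℂ)^2-1) / ((d * D)^2-1)) • (1 - RC d D) := by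
  have h0 : (d:ℂ) ≠ 0 := by exact_mod_cast (by omega : d ≠ 0)
  have h1 : (D:ℂ) ≠ 0 := by exact_mod_cast (by omega : D ≠ 0)
  have h2 : (d:ℂ) * (D:ℂ)^2 + 1 ≠ 0 := by exact_mod_cast (by omega : d * D^2 + 1 ≠ 0)
  have h3 : ((d:ℂ) * D)^2 - 1 ≠ 0 := by
    rw [sub_ne_zero]
    have : (d*D)^2 ≠ 1 := by
      have : 4 ≤ d * D := by nlinarith
      nlinarith
    exact_mod_cast this
  have h3' : (d:ℂ)^2 * (D:ℂ)^2 - 1 ≠ 0 := by rwa [mul_pow] at h3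
  unfold CC
  rw [Matrix.mul_assoc, BB_gram]
  split_ifs
  · ext i j
    fin_cases i <;> fin_cases j <;> simp [WW, RA, Matrix.mul_apply, Fin.sum_univ_two] <;> field_simp <;> ring
  · ext i j
    fin_cases i <;> fin_cases j <;> simp [WW, RC, Matrix.mul_apply, Fin.sum_univ_two] <;> field_simp <;> ring

lemma real_bound (x y e : ℝ) (l r : ℕ) (hl : 1 ≤ l) (hr : 1 ≤ r) (hx : 2 ≤ x) (hy : 2 ≤ y)
    (he : e = x * (y^2-1)/((x*y)^2-1)) :
    (y*(x+1)/(x*y^2+1))^2 * (1 + e^l*e^r) + (e^l+e^r) * (1 - (y*(x+1)/(x*y^2+1))^2)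
      ≤ (x^l)⁻¹ + (x^r)⁻¹ + 4 * (y^2)⁻¹ := by
  have hden : 0 < (x*y)^2 - 1 := by nlinarith [mul_le_mul hx hy (by norm_num) (by linarith)]
  have he0 : 0 ≤ e := by rw [he]; exact div_nonneg (mul_nonneg (by linarith) (by nlinarith)) hden.le
  have hex : e ≤ x⁻¹ := by
    rw [he, div_le_iff₀ hden, inv_mul_eq_div, le_div_iff₀ (by linarith)]
    nlinarith
  have hel : e^l ≤ (x^l)⁻¹ := by rw [← inv_pow]; exact pow_le_pow_left₀ he0 hex l
  have her : e^r ≤ (x^r)⁻¹ := by rw [← inv_pow]; exact pow_le_pow_left₀ he0 hex r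
  have hehalf : e ≤ 1/2 := hex.trans (by rw [inv_le_comm₀ (by linarith) (by norm_num)]; linarith)
  have hl' : e^l ≤ 1/2 := (pow_le_of_le_one he0 (by linarith) (by omega)).trans hehalf
  have hr' : e^r ≤ 1/2 := (pow_le_of_le_one he0 (by linarith) (by omega)).trans hehalf
  have hl0 : 0 ≤ e^l := by positivity
  have hr0 : 0 ≤ e^r := by positivity
  set t := (y*(x+1)/(x*y^2+1))^2 with ht
  have ht0 : 0 ≤ t := by positivity
  have hs : y*(x+1)/(x*y^2+1) ≤ (3/2) / y := by
    rw [div_le_div_iff₀ (by positivity) (by linarith)]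
    nlinarith [mul_nonneg (sub_nonneg.2 hx) (sq_nonneg y)]
  have hty : t ≤ (9/4) * (y^2)⁻¹ := by
    rw [ht]
    calc _ ≤ ((3/2)/y)^2 := pow_le_pow_left₀ (by positivity) hs 2
      _ = _ := by rw [div_pow]; ring
  have hy2 : 0 ≤ (y^2)⁻¹ := by positivity
  nlinarith [mul_le_mul hl' hr' hr0 (by norm_num), mul_nonneg ht0 hl0, mul_nonneg ht0 hr0,
    mul_le_mul_of_nonneg_left (mul_le_mul hl' hr' hr0 (by norm_num)) ht0]

end final

/-- expected purity of a connected block.  Let `1 ≤ l < n` and let `A` be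
the block of the first `l` sites.  Then `E Tr[ρ_A²] ≤ d^{−l} + d^{−(n−l)} + 4 D^{−2}`,
with the site unitaries drawn i.i.d. from the Haar probability measure on `U(dD)` (the
unique left-invariant Borel probability measure).  The inequality is stated in the
complex order, the right-hand side being a real scalar. -/
theorem expected_purity_block
    (d D n l : ℕ) [NeZero d] (hd : 2 ≤ d) (hD : 2 ≤ D) (hl : 1 ≤ l) (hln : l < n)
    (μ : Measure (Matrix.unitaryGroup (Fin d × Fin D) ℂ)) [IsProbabilityMeasure μ]
    (hHaar : ∀ V : Matrix.unitaryGroup (Fin d × Fin D) ℂ, μ.map (fun U => V * U) = μ) :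
    ∫ U, Matrix.trace
        (rhoA (Finset.univ.filter fun i : Fin n => (i : ℕ) < l) (mps d D n U) *
          rhoA (Finset.univ.filter fun i : Fin n => (i : ℕ) < l) (mps d D n U))
        ∂(Measure.pi fun _ : Fin n => μ)
      ≤ (((((d : ℝ) ^ l)⁻¹ + ((d : ℝ) ^ (n - l))⁻¹ + 4 * ((D : ℝ) ^ 2)⁻¹) : ℝ) : ℂ) := by
  obtain ⟨k, rfl⟩ : ∃ k, n = k + 1 := ⟨n - 1, by omega⟩
  rw [integral_purity k d D hd hD _ μ hHaar]
  simp_rw [T_eq d D hd hD]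
  simp only [Finset.mem_filter, Finset.mem_univ, true_and]
  rw [list_split l (k+1) hln.le]
  have h2 : (d:ℂ) * (D:ℂ)^2 + 1 ≠ 0 := by exact_mod_cast (by omega : d * D^2 + 1 ≠ 0)
  rw [proj_pow _ (RA_proj _ _ h2), proj_pow _ (RC_proj _ _ h2), trace_final _ _ _ _ h2]
  have hb := real_bound d D _ l (k+1-l) hl (by omega) (by exact_mod_cast hd) (by exact_mod_cast hD) rfl
  refine le_of_eq_of_le ?_ (Complex.real_le_real.mpr hb)
  push_cast
  ring
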